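/- For every p, q ∈ V, the maps x ↦ p·x·q and x ↦ p·x̄·q on the quaternions restrict to bijections of V onto itself, and the set of all permutations of V arising in this way (as p and q range over V and both types of map are allowed) has exactly 14400 elements: 7200 permutations of the first type (orientation-preserving) and 7200 of the second type (orientation-reversing). This set realizes the full symmetry group of the 120-cell. -/

import Mathlib

open Quaternion

noncomputable section

/-- The golden ratio. -/
def gold : ℝ := (1 + Real.sqrt 5) / 2

/-- The coordinates of a quaternion, viewed as a vector in `ℝ⁴`. -/
def qcoords (q : ℍ[ℝ]) : Fin 4 → ℝ := ![q.re, q.imI, q.imJ, q.imK]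

/-- The standard inner product of two quaternions viewed as vectors in `ℝ⁴`. -/
def qinner (p q : ℍ[ℝ]) : ℝ := ∑ i, qcoords p i * qcoords q i

/-- A choice of signs. -/
def IsSign (s : Fin 4 → ℝ) : Prop := ∀ i, s i = 1 ∨ s i = -1

/-- The coordinate multiset `(0, 1, φ⁻¹, φ)`. -/
def baseVec : Fin 4 → ℝ := ![0, 1, gold⁻¹, gold]

/-- The 120 facet centers of the right-angled 120-cell: the 24 Hurwitz units
`±1, ±i, ±j, ±k, (±1±i±j±k)/2` together with the 96 quaternions obtained from
`(0 ± i ± φ⁻¹j ± φk)/2` by even permutations of the coordinates `(0,1,φ⁻¹,φ)`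
and all choices of signs. -/
def Vcell : Set ℍ[ℝ] :=
  {q | (∃ s : Fin 4 → ℝ, IsSign s ∧
          ((∃ i : Fin 4, ∀ j, qcoords q j = if j = i then s i else 0) ∨
           (∀ j, qcoords q j = s j / 2))) ∨
       (∃ σ : Equiv.Perm (Fin 4), σ ∈ alternatingGroup (Fin 4) ∧
          ∃ s : Fin 4 → ℝ, IsSign s ∧ ∀ j, qcoords q j = s j * baseVec (σ j) / 2)}

/-- Facet adjacency in the 120-cell: two facet centers are adjacent iff their
inner product equals `φ/2 = cos (π/5)`. -/
def Adj (p q : ℍ[ℝ]) : Prop := p ∈ Vcell ∧ q ∈ Vcell ∧ qinner p q = gold / 2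

/-- A nonsingular coloring (characteristic function) of the 120-cell: facets get
nonzero colors in `(ℤ/2)⁴` and any four pairwise adjacent facets get a basis. -/
def Nonsingular (lam : ℍ[ℝ] → (Fin 4 → ZMod 2)) : Prop :=
  (∀ q ∈ Vcell, lam q ≠ 0) ∧
  ∀ a b c d : ℍ[ℝ], Adj a b → Adj a c → Adj a d → Adj b c → Adj b d → Adj c d →
    LinearIndependent (ZMod 2) ![lam a, lam b, lam c, lam d]

/-- The symmetry group of the 120-cell, realized as the permutations of `Vcell`
of the form `x ↦ pxq` or `x ↦ p x̄ q` with `p, q ∈ Vcell`. -/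
def SymE : Set (ℍ[ℝ] → ℍ[ℝ]) :=
  {f | ∃ p ∈ Vcell, ∃ q ∈ Vcell,
        (f = fun x => p * x * q) ∨ (f = fun x => p * star x * q)}

/-- DJ-equivalence of colorings: `λ = g ∘ μ ∘ a` on the facets, for some
`g ∈ GL₄(ℤ/2)` and some symmetry `a` of the 120-cell. -/
def DJEquiv (lam mu : ℍ[ℝ] → (Fin 4 → ZMod 2)) : Prop :=
  ∃ g : (Fin 4 → ZMod 2) ≃ₗ[ZMod 2] (Fin 4 → ZMod 2),
    ∃ a ∈ SymE, ∀ x ∈ Vcell, lam x = g (mu (a x))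

/-- Orientability (Nakayama–Nishimura): after a change of basis every color has
odd weight. -/
def OrientableColoring (lam : ℍ[ℝ] → (Fin 4 → ZMod 2)) : Prop :=
  ∃ g : (Fin 4 → ZMod 2) ≃ₗ[ZMod 2] (Fin 4 → ZMod 2),
    ∀ x ∈ Vcell, ∑ i, g (lam x) i = 1


/-! A computable model: doubled coordinates in `ℤ[φ]` -/

/-- Four elements `a + bφ` of `ℤ[φ]`: the doubled coordinates of an icosian. -/
structure Ico where
  a : ℤ × ℤ
  b : ℤ × ℤ
  c : ℤ × ℤ
  d : ℤ × ℤ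

namespace Ico

/-- Fast equality test for integers. -/
def ieq : ℤ → ℤ → Bool
  | Int.ofNat m, Int.ofNat n => Nat.beq m n
  | Int.negSucc m, Int.negSucc n => Nat.beq m n
  | _, _ => false

theorem ieq_iff (x y : ℤ) : ieq x y = true ↔ x = y := by
  cases x <;> cases y <;> simp [ieq]

/-- Fast equality test for icosians. -/
def eqB (x y : Ico) : Bool :=
  ieq x.a.1 y.a.1 && (ieq x.a.2 y.a.2 && (ieq x.b.1 y.b.1 && (ieq x.b.2 y.b.2 &&
    (ieq x.c.1 y.c.1 && (ieq x.c.2 y.c.2 && (ieq x.d.1 y.d.1 && ieq x.d.2 y.d.2))))))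

theorem eqB_iff (x y : Ico) : eqB x y = true ↔ x = y := by
  rcases x with ⟨⟨_, _⟩, ⟨_, _⟩, ⟨_, _⟩, ⟨_, _⟩⟩
  rcases y with ⟨⟨_, _⟩, ⟨_, _⟩, ⟨_, _⟩, ⟨_, _⟩⟩
  simp [eqB, ieq_iff, and_assoc]

instance : DecidableEq Ico := fun x y => decidable_of_iff _ (eqB_iff x y)

def zm (x y : ℤ × ℤ) : ℤ × ℤ := (x.1 * y.1 + x.2 * y.2, x.1 * y.2 + x.2 * y.1 + x.2 * y.2)
def zadd (x y : ℤ × ℤ) : ℤ × ℤ := (x.1 + y.1, x.2 + y.2)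
def zneg (x : ℤ × ℤ) : ℤ × ℤ := (-x.1, -x.2)
def zhalf (x : ℤ × ℤ) : ℤ × ℤ := (x.1 / 2, x.2 / 2)

def neg (x : Ico) : Ico := ⟨zneg x.a, zneg x.b, zneg x.c, zneg x.d⟩
def conj (x : Ico) : Ico := ⟨x.a, zneg x.b, zneg x.c, zneg x.d⟩
def half (x : Ico) : Ico := ⟨zhalf x.a, zhalf x.b, zhalf x.c, zhalf x.d⟩
def dbl (x : Ico) : Ico := ⟨zadd x.a x.a, zadd x.b x.b, zadd x.c x.c, zadd x.d x.d⟩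

def mul (x y : Ico) : Ico :=
  ⟨zadd (zadd (zm x.a y.a) (zneg (zm x.b y.b))) (zadd (zneg (zm x.c y.c)) (zneg (zm x.d y.d))),
   zadd (zadd (zm x.a y.b) (zm x.b y.a)) (zadd (zm x.c y.d) (zneg (zm x.d y.c))),
   zadd (zadd (zm x.a y.c) (zneg (zm x.b y.d))) (zadd (zm x.c y.a) (zm x.d y.b)),
   zadd (zadd (zm x.a y.d) (zm x.b y.c)) (zadd (zneg (zm x.c y.b)) (zm x.d y.a))⟩

/-- Product of icosians (in doubled coordinates), exact when `Exact` holds. -/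
def pr (x y : Ico) : Ico := half (mul x y)

def Exact (x y : Ico) : Prop := mul x y = dbl (pr x y)
instance (x y : Ico) : Decidable (Exact x y) := inferInstanceAs (Decidable (_ = _))

def co (x : Ico) : Fin 4 → ℤ × ℤ := ![x.a, x.b, x.c, x.d]

def one : Ico := ⟨(2,0),(0,0),(0,0),(0,0)⟩
def gi : Ico := ⟨(0,0),(2,0),(0,0),(0,0)⟩
def gj : Ico := ⟨(0,0),(0,0),(2,0),(0,0)⟩
def gw : Ico := ⟨(-1,0),(1,0),(1,0),(1,0)⟩
def gc : Ico := ⟨(-1,1),(0,0),(1,0),(0,1)⟩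

def prods (A B : List Ico) : List Ico := A.flatMap fun x => B.map fun y => pr x y

def A1 : List Ico := [one, gj]
def A2 : List Ico := [one, gi]
def A3 : List Ico := [one, gw, pr gw gw]
def A4 : List Ico := [one, gc, pr gc gc, pr gc (pr gc gc), pr gc (pr gc (pr gc gc))]
def B2 : List Ico := prods A2 A1
def B3 : List Ico := prods A3 B2
/-- Representatives of the icosians modulo sign. -/
def Lh : List Ico :=
  [⟨(2,0),(0,0),(0,0),(0,0)⟩,
   ⟨(0,0),(0,0),(2,0),(0,0)⟩,
   ⟨(0,0),(2,0),(0,0),(0,0)⟩,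
   ⟨(0,0),(0,0),(0,0),(2,0)⟩,
   ⟨(-1,0),(1,0),(1,0),(1,0)⟩,
   ⟨(-1,0),(-1,0),(-1,0),(1,0)⟩,
   ⟨(-1,0),(-1,0),(1,0),(-1,0)⟩,
   ⟨(-1,0),(1,0),(-1,0),(-1,0)⟩,
   ⟨(-1,0),(-1,0),(-1,0),(-1,0)⟩,
   ⟨(1,0),(1,0),(-1,0),(-1,0)⟩,
   ⟨(1,0),(-1,0),(-1,0),(1,0)⟩,
   ⟨(1,0),(-1,0),(1,0),(-1,0)⟩,
   ⟨(-1,1),(0,0),(1,0),(0,1)⟩,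
   ⟨(-1,0),(0,-1),(-1,1),(0,0)⟩,
   ⟨(0,0),(-1,1),(0,1),(-1,0)⟩,
   ⟨(0,-1),(1,0),(0,0),(-1,1)⟩,
   ⟨(0,-1),(0,0),(-1,1),(-1,0)⟩,
   ⟨(1,-1),(1,0),(0,-1),(0,0)⟩,
   ⟨(0,0),(0,-1),(-1,0),(1,-1)⟩,
   ⟨(1,0),(-1,1),(0,0),(0,-1)⟩,
   ⟨(1,0),(0,0),(0,-1),(1,-1)⟩,
   ⟨(0,1),(-1,1),(1,0),(0,0)⟩,
   ⟨(0,0),(1,0),(1,-1),(0,1)⟩,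
   ⟨(-1,1),(0,-1),(0,0),(1,0)⟩,
   ⟨(0,-1),(0,0),(-1,1),(1,0)⟩,
   ⟨(1,-1),(-1,0),(0,-1),(0,0)⟩,
   ⟨(0,0),(0,-1),(1,0),(1,-1)⟩,
   ⟨(-1,0),(-1,1),(0,0),(0,-1)⟩,
   ⟨(0,0),(-1,0),(1,-1),(0,-1)⟩,
   ⟨(-1,1),(0,1),(0,0),(-1,0)⟩,
   ⟨(1,0),(0,0),(0,-1),(-1,1)⟩,
   ⟨(0,1),(1,-1),(1,0),(0,0)⟩,
   ⟨(0,1),(1,0),(0,0),(-1,1)⟩,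
   ⟨(0,0),(1,-1),(0,1),(1,0)⟩,
   ⟨(-1,0),(0,1),(-1,1),(0,0)⟩,
   ⟨(1,-1),(0,0),(-1,0),(0,1)⟩,
   ⟨(0,-1),(0,0),(1,-1),(-1,0)⟩,
   ⟨(-1,1),(1,0),(0,-1),(0,0)⟩,
   ⟨(0,0),(0,-1),(-1,0),(-1,1)⟩,
   ⟨(1,0),(1,-1),(0,0),(0,-1)⟩,
   ⟨(0,1),(1,-1),(-1,0),(0,0)⟩,
   ⟨(1,0),(0,0),(0,1),(1,-1)⟩,
   ⟨(-1,1),(0,1),(0,0),(1,0)⟩,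
   ⟨(0,0),(-1,0),(-1,1),(0,1)⟩,
   ⟨(0,0),(-1,1),(0,1),(1,0)⟩,
   ⟨(0,-1),(-1,0),(0,0),(-1,1)⟩,
   ⟨(1,-1),(0,0),(1,0),(0,-1)⟩,
   ⟨(-1,0),(0,1),(1,-1),(0,0)⟩,
   ⟨(-1,1),(0,0),(-1,0),(0,-1)⟩,
   ⟨(1,0),(0,1),(-1,1),(0,0)⟩,
   ⟨(0,0),(-1,1),(0,-1),(1,0)⟩,
   ⟨(0,1),(-1,0),(0,0),(-1,1)⟩,
   ⟨(1,0),(-1,1),(0,0),(0,1)⟩,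
   ⟨(0,0),(0,-1),(1,0),(-1,1)⟩,
   ⟨(1,-1),(1,0),(0,1),(0,0)⟩,
   ⟨(0,-1),(0,0),(1,-1),(1,0)⟩,
   ⟨(0,-1),(1,-1),(1,0),(0,0)⟩,
   ⟨(-1,0),(0,0),(0,-1),(1,-1)⟩,
   ⟨(-1,1),(0,-1),(0,0),(-1,0)⟩,
   ⟨(0,0),(1,0),(-1,1),(0,-1)⟩]
/-- All 120 icosians. -/
def L : List Ico := Lh ++
  [⟨(-2,0),(0,0),(0,0),(0,0)⟩,
   ⟨(0,0),(0,0),(-2,0),(0,0)⟩,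
   ⟨(0,0),(-2,0),(0,0),(0,0)⟩,
   ⟨(0,0),(0,0),(0,0),(-2,0)⟩,
   ⟨(1,0),(-1,0),(-1,0),(-1,0)⟩,
   ⟨(1,0),(1,0),(1,0),(-1,0)⟩,
   ⟨(1,0),(1,0),(-1,0),(1,0)⟩,
   ⟨(1,0),(-1,0),(1,0),(1,0)⟩,
   ⟨(1,0),(1,0),(1,0),(1,0)⟩,
   ⟨(-1,0),(-1,0),(1,0),(1,0)⟩,
   ⟨(-1,0),(1,0),(1,0),(-1,0)⟩,
   ⟨(-1,0),(1,0),(-1,0),(1,0)⟩,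
   ⟨(1,-1),(0,0),(-1,0),(0,-1)⟩,
   ⟨(1,0),(0,1),(1,-1),(0,0)⟩,
   ⟨(0,0),(1,-1),(0,-1),(1,0)⟩,
   ⟨(0,1),(-1,0),(0,0),(1,-1)⟩,
   ⟨(0,1),(0,0),(1,-1),(1,0)⟩,
   ⟨(-1,1),(-1,0),(0,1),(0,0)⟩,
   ⟨(0,0),(0,1),(1,0),(-1,1)⟩,
   ⟨(-1,0),(1,-1),(0,0),(0,1)⟩,
   ⟨(-1,0),(0,0),(0,1),(-1,1)⟩,
   ⟨(0,-1),(1,-1),(-1,0),(0,0)⟩,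
   ⟨(0,0),(-1,0),(-1,1),(0,-1)⟩,
   ⟨(1,-1),(0,1),(0,0),(-1,0)⟩,
   ⟨(0,1),(0,0),(1,-1),(-1,0)⟩,
   ⟨(-1,1),(1,0),(0,1),(0,0)⟩,
   ⟨(0,0),(0,1),(-1,0),(-1,1)⟩,
   ⟨(1,0),(1,-1),(0,0),(0,1)⟩,
   ⟨(0,0),(1,0),(-1,1),(0,1)⟩,
   ⟨(1,-1),(0,-1),(0,0),(1,0)⟩,
   ⟨(-1,0),(0,0),(0,1),(1,-1)⟩,
   ⟨(0,-1),(-1,1),(-1,0),(0,0)⟩,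
   ⟨(0,-1),(-1,0),(0,0),(1,-1)⟩,
   ⟨(0,0),(-1,1),(0,-1),(-1,0)⟩,
   ⟨(1,0),(0,-1),(1,-1),(0,0)⟩,
   ⟨(-1,1),(0,0),(1,0),(0,-1)⟩,
   ⟨(0,1),(0,0),(-1,1),(1,0)⟩,
   ⟨(1,-1),(-1,0),(0,1),(0,0)⟩,
   ⟨(0,0),(0,1),(1,0),(1,-1)⟩,
   ⟨(-1,0),(-1,1),(0,0),(0,1)⟩,
   ⟨(0,-1),(-1,1),(1,0),(0,0)⟩,
   ⟨(-1,0),(0,0),(0,-1),(-1,1)⟩,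
   ⟨(1,-1),(0,-1),(0,0),(-1,0)⟩,
   ⟨(0,0),(1,0),(1,-1),(0,-1)⟩,
   ⟨(0,0),(1,-1),(0,-1),(-1,0)⟩,
   ⟨(0,1),(1,0),(0,0),(1,-1)⟩,
   ⟨(-1,1),(0,0),(-1,0),(0,1)⟩,
   ⟨(1,0),(0,-1),(-1,1),(0,0)⟩,
   ⟨(1,-1),(0,0),(1,0),(0,1)⟩,
   ⟨(-1,0),(0,-1),(1,-1),(0,0)⟩,
   ⟨(0,0),(1,-1),(0,1),(-1,0)⟩,
   ⟨(0,-1),(1,0),(0,0),(1,-1)⟩,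
   ⟨(-1,0),(1,-1),(0,0),(0,-1)⟩,
   ⟨(0,0),(0,1),(-1,0),(1,-1)⟩,
   ⟨(-1,1),(-1,0),(0,-1),(0,0)⟩,
   ⟨(0,1),(0,0),(-1,1),(-1,0)⟩,
   ⟨(0,1),(-1,1),(-1,0),(0,0)⟩,
   ⟨(1,0),(0,0),(0,1),(-1,1)⟩,
   ⟨(1,-1),(0,1),(0,0),(1,0)⟩,
   ⟨(0,0),(-1,0),(1,-1),(0,1)⟩]

def base : Fin 4 → ℤ × ℤ := ![(0,0),(1,0),(-1,1),(0,1)]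

def Shape (x : Ico) : Prop :=
  (∃ i : Fin 4, ∀ j, if j = i then x.co j = (2,0) ∨ x.co j = (-2,0) else x.co j = (0,0)) ∨
  (∀ j, x.co j = (1,0) ∨ x.co j = (-1,0)) ∨
  ∃ σ : Equiv.Perm (Fin 4), Equiv.Perm.sign σ = 1 ∧
    ∀ j, x.co j = base (σ j) ∨ x.co j = zneg (base (σ j))

instance (x : Ico) : Decidable (Shape x) := by unfold Shape; infer_instance

def sg (t : Bool) (x : ℤ × ℤ) : ℤ × ℤ := if t then x else zneg x
def ofFun (f : Fin 4 → ℤ × ℤ) : Ico := ⟨f 0, f 1, f 2, f 3⟩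

theorem Lh_eq : Lh = prods A4 B3 := by decide +kernel
theorem L_eq : L = Lh ++ Lh.map neg := by decide +kernel
theorem L_length : L.length = 120 := by decide +kernel
theorem L_nodup : L.Nodup := by decide +kernel
theorem L_shape : ∀ x ∈ L, Shape x := by decide +kernel
theorem mem_L1 : ∀ i : Fin 4, ∀ t : Bool,
    ofFun (fun j => if j = i then sg t (2,0) else (0,0)) ∈ L := by decide +kernel
theorem mem_L2 : ∀ t0 t1 t2 t3 : Bool,
    ofFun (fun j => sg (![t0,t1,t2,t3] j) (1,0)) ∈ L := by decide +kernel
theorem mem_L3 : ∀ σ : Equiv.Perm (Fin 4), Equiv.Perm.sign σ = 1 → ∀ t0 t1 t2 t3 : Bool,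
    ofFun (fun j => sg (![t0,t1,t2,t3] j) (base (σ j))) ∈ L := by decide +kernel
theorem L_gen : ∀ g ∈ [gi, gj, gw, gc], ∀ x ∈ L, Exact g x ∧ pr g x ∈ L := by decide +kernel
theorem L_conj : ∀ x ∈ L, conj x ∈ L ∧ mul x (conj x) = ⟨(4,0),(0,0),(0,0),(0,0)⟩ := by
  decide +kernel
theorem ex_w : Exact gw gw := by decide +kernel
theorem ex_c1 : Exact gc gc := by decide +kernel
theorem ex_c2 : Exact gc (pr gc gc) := by decide +kernel
theorem ex_c3 : Exact gc (pr gc (pr gc gc)) := by decide +kernel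
theorem ex_2 : ∀ x ∈ A2, ∀ y ∈ A1, Exact x y := by decide +kernel
theorem ex_3 : ∀ x ∈ A3, ∀ y ∈ B2, Exact x y := by decide +kernel
theorem ex_4 : ∀ x ∈ A4, ∀ y ∈ B3, Exact x y := by decide +kernel

end Ico

/-! Interpretation in the real quaternions -/

theorem gold_sq : gold * gold = gold + 1 := by
  have h : Real.sqrt 5 * Real.sqrt 5 = 5 := Real.mul_self_sqrt (by norm_num)
  unfold gold
  linear_combination h / 4

theorem gold_inv : gold⁻¹ = gold - 1 := by
  have h := gold_sq
  have h0 : gold ≠ 0 := by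
    intro h0
    rw [h0] at h
    norm_num at h
  field_simp
  linear_combination -h

theorem gold_irr : Irrational gold := by
  have h := Real.goldenRatio_irrational
  exact h

namespace Ico

def zv (x : ℤ × ℤ) : ℝ := x.1 + x.2 * gold

theorem zv_add (x y : ℤ × ℤ) : zv (zadd x y) = zv x + zv y := by
  simp only [zv, zadd]; push_cast; ring
theorem zv_neg (x : ℤ × ℤ) : zv (zneg x) = -zv x := by
  simp only [zv, zneg]; push_cast; ring
theorem zv_mul (x y : ℤ × ℤ) : zv (zm x y) = zv x * zv y := by
  simp only [zv, zm]; push_cast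
  linear_combination (-(x.2 : ℝ) * y.2) * gold_sq

theorem zv_inj {x y : ℤ × ℤ} (h : zv x = zv y) : x = y := by
  simp only [zv] at h
  have h2 : x.2 = y.2 := by
    by_contra hne
    have hne' : ((y.2 : ℝ) - x.2) ≠ 0 := by
      intro h0
      apply hne
      have : (y.2 : ℝ) = x.2 := by linarith
      exact_mod_cast this.symm
    apply gold_irr
    refine ⟨((x.1 - y.1 : ℤ) : ℚ) / ((y.2 - x.2 : ℤ) : ℚ), ?_⟩
    push_cast
    rw [div_eq_iff hne']
    linarith
  rw [h2] at h
  have h1 : (x.1 : ℝ) = y.1 := by linarith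
  exact Prod.ext (by exact_mod_cast h1) h2

/-- A quaternion from its coordinates. -/
def mkq (a b c d : ℝ) : ℍ[ℝ] := ⟨a, b, c, d⟩
@[simp] theorem mkq_re (a b c d : ℝ) : (mkq a b c d).re = a := rfl
@[simp] theorem mkq_imI (a b c d : ℝ) : (mkq a b c d).imI = b := rfl
@[simp] theorem mkq_imJ (a b c d : ℝ) : (mkq a b c d).imJ = c := rfl
@[simp] theorem mkq_imK (a b c d : ℝ) : (mkq a b c d).imK = d := rfl

/-- The real quaternion with given doubled coordinates. -/
def toQ (x : Ico) : ℍ[ℝ] := mkq (zv x.a / 2) (zv x.b / 2) (zv x.c / 2) (zv x.d / 2)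

theorem toQ_inj : Function.Injective toQ := by
  intro x y h
  have h1 := congrArg QuaternionAlgebra.re h
  have h2 := congrArg QuaternionAlgebra.imI h
  have h3 := congrArg QuaternionAlgebra.imJ h
  have h4 := congrArg QuaternionAlgebra.imK h
  simp only [toQ, mkq_re, mkq_imI, mkq_imJ, mkq_imK] at h1 h2 h3 h4
  cases x; cases y
  congr 1 <;> apply zv_inj <;> linarith

theorem toQ_neg (x : Ico) : toQ (neg x) = -toQ x := by
  ext <;> simp [toQ, neg, zv_neg, neg_div]

theorem toQ_conj (x : Ico) : toQ (conj x) = star (toQ x) := by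
  ext <;> simp [toQ, conj, zv_neg, neg_div]

theorem toQ_mul (x y z : Ico) (h : mul x y = dbl z) : toQ x * toQ y = toQ z := by
  have h1 := congrArg (fun w => zv w.a) h
  have h2 := congrArg (fun w => zv w.b) h
  have h3 := congrArg (fun w => zv w.c) h
  have h4 := congrArg (fun w => zv w.d) h
  simp only [mul, dbl, zv_add, zv_neg, zv_mul] at h1 h2 h3 h4
  ext
  · simp [toQ]; linarith
  · simp [toQ]; linarith
  · simp [toQ]; linarith
  · simp [toQ]; linarith

theorem toQ_pr (x y : Ico) (h : Exact x y) : toQ (pr x y) = toQ x * toQ y :=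
  (toQ_mul x y _ h).symm

theorem toQ_one : toQ one = 1 := by
  ext <;> simp [toQ, one, zv]

theorem qcoords_toQ (x : Ico) (j : Fin 4) : qcoords (toQ x) j = zv (x.co j) / 2 := by
  fin_cases j <;> rfl

theorem qcoords_inj {p q : ℍ[ℝ]} (h : ∀ j, qcoords p j = qcoords q j) : p = q := by
  ext
  · exact h 0
  · exact h 1
  · exact h 2
  · exact h 3

theorem co_ofFun (f : Fin 4 → ℤ × ℤ) (j : Fin 4) : (ofFun f).co j = f j := by
  fin_cases j <;> rfl

theorem zv_base (j : Fin 4) : zv (base j) = baseVec j := by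
  fin_cases j <;> simp [zv, base, baseVec, gold_inv]
  ring

theorem zv_sg (t : Bool) (x : ℤ × ℤ) : zv (sg t x) = (if t then 1 else -1) * zv x := by
  cases t <;> simp [sg, zv_neg]

theorem sign_bool {s : Fin 4 → ℝ} (hs : IsSign s) :
    ∃ t : Fin 4 → Bool, ∀ j, s j = if t j then 1 else -1 := by
  have : ∀ j, ∃ t : Bool, s j = if t then 1 else -1 := by
    intro j
    rcases hs j with h | h
    · exact ⟨true, by simp [h]⟩
    · exact ⟨false, by simp [h]⟩
  exact ⟨fun j => (this j).choose, fun j => (this j).choose_spec⟩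

theorem vec_eta (t : Fin 4 → Bool) : ![t 0, t 1, t 2, t 3] = t := by
  funext j; fin_cases j <;> rfl

theorem Vcell_eq : Vcell = toQ '' {x | x ∈ L} := by
  ext q
  constructor
  · rintro (⟨s, hs, (⟨i, hi⟩ | h)⟩ | ⟨σ, hσ, s, hs, h⟩)
    · obtain ⟨t, ht⟩ := sign_bool hs
      refine ⟨_, mem_L1 i (t i), qcoords_inj fun j => ?_⟩
      rw [qcoords_toQ, co_ofFun, hi, ht]
      by_cases hj : j = i
      · simp only [hj, if_true, zv_sg]; cases t i <;> simp [zv]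
      · simp [hj, zv]
    · obtain ⟨t, ht⟩ := sign_bool hs
      refine ⟨_, mem_L2 (t 0) (t 1) (t 2) (t 3), qcoords_inj fun j => ?_⟩
      rw [qcoords_toQ, co_ofFun, h, ht, vec_eta, zv_sg]
      simp [zv]
    · obtain ⟨t, ht⟩ := sign_bool hs
      refine ⟨_, mem_L3 σ (Equiv.Perm.mem_alternatingGroup.1 hσ) (t 0) (t 1) (t 2) (t 3),
        qcoords_inj fun j => ?_⟩
      rw [qcoords_toQ, co_ofFun, h, ht, vec_eta, zv_sg, zv_base]
  · rintro ⟨x, hx, rfl⟩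
    rcases L_shape x hx with ⟨i, hi⟩ | h | ⟨σ, hσ, h⟩
    · left
      have h2 := hi i
      rw [if_pos rfl] at h2
      rcases h2 with h2 | h2
      · refine ⟨fun _ => 1, fun _ => Or.inl rfl, Or.inl ⟨i, fun j => ?_⟩⟩
        rw [qcoords_toQ]
        by_cases hj : j = i
        · subst hj; rw [h2]; simp [zv]
        · have h3 := hi j
          rw [if_neg hj] at h3
          rw [h3, if_neg hj]; simp [zv]
      · refine ⟨fun _ => -1, fun _ => Or.inr rfl, Or.inl ⟨i, fun j => ?_⟩⟩
        rw [qcoords_toQ]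
        by_cases hj : j = i
        · subst hj; rw [h2]; simp [zv]
        · have h3 := hi j
          rw [if_neg hj] at h3
          rw [h3, if_neg hj]; simp [zv]
    · left
      refine ⟨fun j => zv (x.co j), fun j => ?_, Or.inr fun j => qcoords_toQ x j⟩
      rcases h j with h | h <;> simp [h, zv]
    · right
      have : ∀ j, ∃ s : ℝ, (s = 1 ∨ s = -1) ∧ zv (x.co j) = s * baseVec (σ j) := by
        intro j
        rcases h j with h | h
        · exact ⟨1, Or.inl rfl, by rw [h, zv_base, one_mul]⟩
        · exact ⟨-1, Or.inr rfl, by rw [h, zv_neg, zv_base, neg_one_mul]⟩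
      choose s hs hs2 using this
      refine ⟨σ, Equiv.Perm.mem_alternatingGroup.2 hσ, s, hs, fun j => ?_⟩
      rw [qcoords_toQ, hs2]

/-- Icosians whose left multiplication preserves the vertex set. -/
def H (x : Ico) : Prop := ∀ v ∈ Vcell, toQ x * v ∈ Vcell

theorem H_one : H one := by
  intro v hv; rwa [toQ_one, one_mul]

theorem H_gen : ∀ g ∈ [gi, gj, gw, gc], H g := by
  intro g hg v hv
  rw [Vcell_eq] at hv ⊢
  obtain ⟨x, hx, rfl⟩ := hv
  obtain ⟨h1, h2⟩ := L_gen g hg x hx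
  exact ⟨_, h2, toQ_pr g x h1⟩

theorem H_pr {x y : Ico} (hx : H x) (hy : H y) (h : Exact x y) : H (pr x y) := by
  intro v hv
  rw [toQ_pr x y h, mul_assoc]
  exact hx _ (hy _ hv)

theorem H_prods {A B : List Ico} (hA : ∀ x ∈ A, H x) (hB : ∀ x ∈ B, H x)
    (h : ∀ x ∈ A, ∀ y ∈ B, Exact x y) : ∀ x ∈ prods A B, H x := by
  intro z hz
  simp only [prods, List.mem_flatMap, List.mem_map] at hz
  obtain ⟨x, hx, y, hy, rfl⟩ := hz
  exact H_pr (hA x hx) (hB y hy) (h x hx y hy)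

theorem neg_mem {v : ℍ[ℝ]} (hv : v ∈ Vcell) : -v ∈ Vcell := by
  have hneg : ∀ x : Ico, neg (neg x) = x := by
    intro x; simp [neg, zneg]
  rw [Vcell_eq] at hv ⊢
  obtain ⟨x, hx, rfl⟩ := hv
  refine ⟨neg x, ?_, toQ_neg x⟩
  simp only [L_eq, Set.mem_ofPred_eq, List.mem_append, List.mem_map] at hx ⊢
  rcases hx with hx | ⟨y, hy, rfl⟩
  · exact Or.inr ⟨x, hx, rfl⟩
  · exact Or.inl (by rwa [hneg])

theorem H_Lh : ∀ x ∈ Lh, H x := by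
  have hi : H gi := H_gen _ (by simp)
  have hj : H gj := H_gen _ (by simp)
  have hw : H gw := H_gen _ (by simp)
  have hc : H gc := H_gen _ (by simp)
  have hc2 := H_pr hc hc ex_c1
  have hc3 := H_pr hc hc2 ex_c2
  have hc4 := H_pr hc hc3 ex_c3
  have hw2 := H_pr hw hw ex_w
  rw [Lh_eq]
  refine H_prods ?_ (H_prods ?_ (H_prods ?_ ?_ ex_2) ex_3) ex_4
  · intro x hx
    simp only [A4, List.mem_cons, List.not_mem_nil, or_false] at hx
    rcases hx with rfl | rfl | rfl | rfl | rfl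
    exacts [H_one, hc, hc2, hc3, hc4]
  · intro x hx
    simp only [A3, List.mem_cons, List.not_mem_nil, or_false] at hx
    rcases hx with rfl | rfl | rfl
    exacts [H_one, hw, hw2]
  · intro x hx
    simp only [A2, List.mem_cons, List.not_mem_nil, or_false] at hx
    rcases hx with rfl | rfl
    exacts [H_one, hi]
  · intro x hx
    simp only [A1, List.mem_cons, List.not_mem_nil, or_false] at hx
    rcases hx with rfl | rfl
    exacts [H_one, hj]

theorem mul_mem {p q : ℍ[ℝ]} (hp : p ∈ Vcell) (hq : q ∈ Vcell) : p * q ∈ Vcell := by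
  rw [Vcell_eq] at hp
  obtain ⟨x, hx, rfl⟩ := hp
  simp only [L_eq, Set.mem_ofPred_eq, List.mem_append, List.mem_map] at hx
  rcases hx with hx | ⟨y, hy, rfl⟩
  · exact H_Lh x hx q hq
  · rw [toQ_neg, neg_mul]
    exact neg_mem (H_Lh y hy q hq)

theorem star_mem {p : ℍ[ℝ]} (hp : p ∈ Vcell) : star p ∈ Vcell := by
  rw [Vcell_eq] at hp ⊢
  obtain ⟨x, hx, rfl⟩ := hp
  exact ⟨_, (L_conj x hx).1, toQ_conj x⟩

theorem mul_star {p : ℍ[ℝ]} (hp : p ∈ Vcell) : p * star p = 1 := by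
  rw [Vcell_eq] at hp
  obtain ⟨x, hx, rfl⟩ := hp
  rw [← toQ_conj, ← toQ_one]
  exact toQ_mul _ _ _ (L_conj x hx).2

theorem star_mul' {p : ℍ[ℝ]} (hp : p ∈ Vcell) : star p * p = 1 := by
  have := mul_star (star_mem hp)
  rwa [star_star] at this

theorem bij1 {p q : ℍ[ℝ]} (hp : p ∈ Vcell) (hq : q ∈ Vcell) :
    Set.BijOn (fun x => p * x * q) Vcell Vcell := by
  refine ⟨fun x hx => mul_mem (mul_mem hp hx) hq, fun x _ y _ h => ?_, fun y hy => ?_⟩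
  · have h' : star p * (p * x * q) * star q = star p * (p * y * q) * star q := by
      simp only at h; rw [h]
    have e : ∀ z, star p * (p * z * q) * star q = (star p * p) * z * (q * star q) := by
      intro z; simp only [mul_assoc]
    rw [e, e, star_mul' hp, mul_star hq] at h'
    simpa using h'
  · refine ⟨star p * y * star q, mul_mem (mul_mem (star_mem hp) hy) (star_mem hq), ?_⟩
    have e : p * (star p * y * star q) * q = (p * star p) * y * (star q * q) := by
      simp only [mul_assoc]
    simp only
    rw [e, star_mul' hq, mul_star hp]; simp

theorem bij2 {p q : ℍ[ℝ]} (hp : p ∈ Vcell) (hq : q ∈ Vcell) :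
    Set.BijOn (fun x => p * star x * q) Vcell Vcell := by
  have hs : Set.BijOn (fun x : ℍ[ℝ] => star x) Vcell Vcell :=
    ⟨fun x hx => star_mem hx, fun x _ y _ h => star_injective h,
      fun y hy => ⟨star y, star_mem hy, star_star y⟩⟩
  exact (bij1 hp hq).comp hs

/-! Counting -/

/-- The sixty representatives modulo sign. -/
def Vh : Set ℍ[ℝ] := toQ '' {x | x ∈ Lh}

theorem ncard_list {l : List Ico} (hl : l.Nodup) : (toQ '' {x | x ∈ l}).ncard = l.length := by
  rw [Set.ncard_image_of_injective _ toQ_inj]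
  have : {x | x ∈ l} = ((l.toFinset : Finset Ico) : Set Ico) := by ext; simp
  rw [this, Set.ncard_coe_finset, List.toFinset_card_of_nodup hl]

theorem ncard_V : Vcell.ncard = 120 := by
  rw [Vcell_eq, ncard_list L_nodup, L_length]

theorem Lh_length : Lh.length = 60 := by
  rfl

theorem ncard_Vh : Vh.ncard = 60 := by
  rw [Vh, ncard_list (List.Nodup.of_append_left L_nodup), Lh_length]

theorem Vh_sub {p : ℍ[ℝ]} (hp : p ∈ Vh) : p ∈ Vcell := by
  rw [Vcell_eq]
  obtain ⟨x, hx, rfl⟩ := hp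
  exact ⟨x, List.mem_append_left _ hx, rfl⟩

theorem V_cases {p : ℍ[ℝ]} (hp : p ∈ Vcell) : p ∈ Vh ∨ -p ∈ Vh := by
  rw [Vcell_eq] at hp
  obtain ⟨x, hx, rfl⟩ := hp
  simp only [L_eq, Set.mem_ofPred_eq, List.mem_append, List.mem_map] at hx
  rcases hx with hx | ⟨y, hy, rfl⟩
  · exact Or.inl ⟨x, hx, rfl⟩
  · right; rw [toQ_neg, neg_neg]; exact ⟨y, hy, rfl⟩

theorem Vh_not_neg {p : ℍ[ℝ]} (hp : p ∈ Vh) : -p ∉ Vh := by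
  rintro ⟨y, hy, hyp⟩
  obtain ⟨x, hx, rfl⟩ := hp
  rw [← toQ_neg] at hyp
  have := toQ_inj hyp
  have hd := List.disjoint_of_nodup_append (L_eq ▸ L_nodup)
  exact hd hy (List.mem_map.2 ⟨x, hx, this.symm⟩)

theorem central {u : ℍ[ℝ]} (h : ∀ x : ℍ[ℝ], u * x = x * u) (hu : u * star u = 1) :
    u = 1 ∨ u = -1 := by
  have h1 := h (mkq 0 1 0 0)
  have h2 := h (mkq 0 0 1 0)
  have a1 := congrArg QuaternionAlgebra.imJ h1
  have a2 := congrArg QuaternionAlgebra.imK h1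
  have a3 := congrArg QuaternionAlgebra.imK h2
  have a4 := congrArg QuaternionAlgebra.re hu
  simp at a1 a2 a3 a4
  have b1 : u.imK = 0 := by linarith
  have b2 : u.imJ = 0 := by linarith
  have b3 : u.imI = 0 := by linarith
  rw [b1, b2, b3] at a4
  have : u.re * u.re = 1 := by linarith
  rcases mul_self_eq_one_iff.1 this with h | h
  · left; ext <;> simp [b1, b2, b3, h]
  · right; ext <;> simp [b1, b2, b3, h]

theorem anti {u : ℍ[ℝ]} (h : ∀ x : ℍ[ℝ], u * x = star x * u) : u = 0 := by
  have h1 := h (mkq 0 1 0 0)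
  have h2 := h (mkq 0 0 1 0)
  have h3 := h (mkq 0 0 0 1)
  have a1 := congrArg QuaternionAlgebra.re h1
  have a2 := congrArg QuaternionAlgebra.imI h1
  have a3 := congrArg QuaternionAlgebra.re h2
  have a4 := congrArg QuaternionAlgebra.re h3
  simp at a1 a2 a3 a4
  ext
  · simp; linarith
  · simp; linarith
  · simp; linarith
  · simp; linarith

def F (pq : ℍ[ℝ] × ℍ[ℝ]) : ℍ[ℝ] → ℍ[ℝ] := fun x => pq.1 * x * pq.2

/-- The quotient of two parametrizations. -/
theorem quot_eq {p q p' q' x y : ℍ[ℝ]} (hq : q ∈ Vcell)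
    (hp' : p' ∈ Vcell) (h : p * x * q = p' * y * q') :
    (star p' * p) * x = y * (q' * star q) := by
  calc (star p' * p) * x = star p' * (p * x * (q * star q)) := by
        rw [mul_star hq]; simp only [mul_one, mul_assoc]
    _ = star p' * (p * x * q) * star q := by simp only [mul_assoc]
    _ = star p' * (p' * y * q') * star q := by rw [h]
    _ = (star p' * p') * y * (q' * star q) := by simp only [mul_assoc]
    _ = y * (q' * star q) := by rw [star_mul' hp', one_mul]

theorem F_injOn : Set.InjOn F (Vh ×ˢ Vcell) := by
  rintro ⟨p, q⟩ ⟨hp, hq⟩ ⟨p', q'⟩ ⟨hp', hq'⟩ h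
  simp only at hp hq hp' hq'
  have hx : ∀ x, p * x * q = p' * x * q' := fun x => congrFun h x
  have hu : ∀ x, (star p' * p) * x = x * (q' * star q) := fun x =>
    quot_eq hq (Vh_sub hp') (hx x)
  have h1 : star p' * p = q' * star q := by simpa using hu 1
  have hc := central (u := star p' * p) (fun x => by rw [hu x, ← h1])
    (mul_star (mul_mem (star_mem (Vh_sub hp')) (Vh_sub hp)))
  have hpe : p = p' * (star p' * p) := by
    rw [← mul_assoc, mul_star (Vh_sub hp'), one_mul]
  rcases hc with hc | hc
  · rw [hc, mul_one] at hpe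
    have hqe : q' = q := by
      have : q' * (star q * q) = q' * star q * q := by rw [mul_assoc]
      rw [star_mul' hq, ← h1, hc] at this
      simpa using this
    rw [hpe, hqe]
  · rw [hc, mul_neg, mul_one] at hpe
    rw [hpe] at hp
    exact absurd hp (Vh_not_neg hp')

theorem set1_eq : {f : ℍ[ℝ] → ℍ[ℝ] | ∃ p ∈ Vcell, ∃ q ∈ Vcell, f = fun x => p * x * q}
    = F '' (Vh ×ˢ Vcell) := by
  ext f
  constructor
  · rintro ⟨p, hp, q, hq, rfl⟩
    rcases V_cases hp with h | h
    · exact ⟨(p, q), ⟨h, hq⟩, rfl⟩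
    · exact ⟨(-p, -q), ⟨h, neg_mem hq⟩, by funext x; simp [F]⟩
  · rintro ⟨⟨p, q⟩, ⟨hp, hq⟩, rfl⟩
    exact ⟨p, Vh_sub hp, q, hq, rfl⟩

theorem card1 : Set.ncard {f : ℍ[ℝ] → ℍ[ℝ] |
    ∃ p ∈ Vcell, ∃ q ∈ Vcell, f = fun x => p * x * q} = 7200 := by
  rw [set1_eq, Set.InjOn.ncard_image F_injOn, Set.ncard_prod, ncard_V, ncard_Vh]

theorem set2_eq : {f : ℍ[ℝ] → ℍ[ℝ] | ∃ p ∈ Vcell, ∃ q ∈ Vcell, f = fun x => p * star x * q}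
    = (fun g : ℍ[ℝ] → ℍ[ℝ] => fun x => g (star x)) '' {f : ℍ[ℝ] → ℍ[ℝ] |
    ∃ p ∈ Vcell, ∃ q ∈ Vcell, f = fun x => p * x * q} := by
  ext f
  constructor
  · rintro ⟨p, hp, q, hq, rfl⟩
    exact ⟨_, ⟨p, hp, q, hq, rfl⟩, rfl⟩
  · rintro ⟨_, ⟨p, hp, q, hq, rfl⟩, rfl⟩
    exact ⟨p, hp, q, hq, rfl⟩

theorem card2 : Set.ncard {f : ℍ[ℝ] → ℍ[ℝ] |
    ∃ p ∈ Vcell, ∃ q ∈ Vcell, f = fun x => p * star x * q} = 7200 := by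
  rw [set2_eq, Set.ncard_image_of_injective _ ?_, card1]
  intro g g' h
  funext x
  have := congrFun h (star x)
  simpa using this

theorem SymE_eq : SymE =
    {f : ℍ[ℝ] → ℍ[ℝ] | ∃ p ∈ Vcell, ∃ q ∈ Vcell, f = fun x => p * x * q} ∪
    {f : ℍ[ℝ] → ℍ[ℝ] | ∃ p ∈ Vcell, ∃ q ∈ Vcell, f = fun x => p * star x * q} := by
  ext f
  constructor
  · rintro ⟨p, hp, q, hq, h | h⟩
    · exact Or.inl ⟨p, hp, q, hq, h⟩
    · exact Or.inr ⟨p, hp, q, hq, h⟩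
  · rintro (⟨p, hp, q, hq, h⟩ | ⟨p, hp, q, hq, h⟩)
    · exact ⟨p, hp, q, hq, Or.inl h⟩
    · exact ⟨p, hp, q, hq, Or.inr h⟩

theorem disj : Disjoint
    {f : ℍ[ℝ] → ℍ[ℝ] | ∃ p ∈ Vcell, ∃ q ∈ Vcell, f = fun x => p * x * q}
    {f : ℍ[ℝ] → ℍ[ℝ] | ∃ p ∈ Vcell, ∃ q ∈ Vcell, f = fun x => p * star x * q} := by
  rw [Set.disjoint_left]
  rintro f ⟨p, hp, q, hq, rfl⟩ ⟨p', hp', q', hq', h⟩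
  have hx : ∀ x, p * x * q = p' * star x * q' := fun x => congrFun h x
  have hu : ∀ x, (star p' * p) * x = star x * (q' * star q) := fun x =>
    quot_eq hq hp' (hx x)
  have h1 : star p' * p = q' * star q := by simpa using hu 1
  have h0 := anti (u := star p' * p) (fun x => by rw [hu x, ← h1])
  have := mul_star (mul_mem (star_mem hp') hp)
  rw [h0] at this
  simp at this

theorem card_all : Set.ncard SymE = 14400 := by
  rw [SymE_eq, Set.ncard_union_eq disj (Set.finite_of_ncard_ne_zero (by rw [card1]; norm_num))
    (Set.finite_of_ncard_ne_zero (by rw [card2]; norm_num)), card1, card2]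

end Ico

/-- The maps `x ↦ pxq` and `x ↦ p x̄ q` (`p, q ∈ Vcell`) restrict to bijections
of `Vcell`, and they realize the full symmetry group of the 120-cell: 14400
symmetries, 7200 orientation-preserving and 7200 orientation-reversing. -/
theorem symmetry_group_of_120cell :
    (∀ p ∈ Vcell, ∀ q ∈ Vcell,
      Set.BijOn (fun x => p * x * q) Vcell Vcell ∧
      Set.BijOn (fun x => p * star x * q) Vcell Vcell) ∧
    Set.ncard SymE = 14400 ∧
    Set.ncard {f : ℍ[ℝ] → ℍ[ℝ] |
      ∃ p ∈ Vcell, ∃ q ∈ Vcell, f = fun x => p * x * q} = 7200 ∧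
    Set.ncard {f : ℍ[ℝ] → ℍ[ℝ] |
      ∃ p ∈ Vcell, ∃ q ∈ Vcell, f = fun x => p * star x * q} = 7200 := by
  exact ⟨fun p hp q hq => ⟨Ico.bij1 hp hq, Ico.bij2 hp hq⟩, Ico.card_all, Ico.card1, Ico.card2⟩
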